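/- Excess error power bound for all measurable functions: Let H_all be the set of all measurable functions X→ℝ and Φ:ℝ→[0,∞) a margin-based loss. Assume there exist s≥1 and c>0 such that for every x∈X, |η(x)−1/2| ≤ c·(inf{ΔC_{ℓ_Φ,H_all}(h,x) : h∈H_all, sign(h(x))·(η(x)−1/2) ≤ 0})^{1/s}. Then for every measurable h:X→ℝ, R_{ℓ_{0-1}}(h) − R*_{ℓ_{0-1},H_all} ≤ 2c·(R_{ℓ_Φ}(h) − R*_{ℓ_Φ,H_all})^{1/s}. -/

import Mathlib

open MeasureTheory Set

noncomputable section

/-- Conditional `ℓ`-risk of `h` at `x` with conditional probability level `t`. -/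
def condRiskT {X : Type*} (ℓ : (X → ℝ) → X → ℝ → ℝ) (h : X → ℝ) (x : X) (t : ℝ) : ℝ :=
  t * ℓ h x 1 + (1 - t) * ℓ h x (-1)

/-- Conditional `ℓ`-risk of `h` at `x`. -/
def condRisk {X : Type*} (ℓ : (X → ℝ) → X → ℝ → ℝ) (η : X → ℝ) (h : X → ℝ) (x : X) : ℝ :=
  condRiskT ℓ h x (η x)

/-- Minimal conditional `ℓ`-risk over the hypothesis set `H` at `x`. -/
def condRiskStar {X : Type*} (ℓ : (X → ℝ) → X → ℝ → ℝ) (η : X → ℝ) (H : Set (X → ℝ))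
    (x : X) : ℝ :=
  sInf ((fun h => condRisk ℓ η h x) '' H)

/-- `ΔC_{ℓ,H}(h,x)`. -/
def deltaC {X : Type*} (ℓ : (X → ℝ) → X → ℝ → ℝ) (η : X → ℝ) (H : Set (X → ℝ))
    (h : X → ℝ) (x : X) : ℝ :=
  condRisk ℓ η h x - condRiskStar ℓ η H x

/-- `ΔC_{ℓ,H}(h,x,t)`. -/
def deltaCT {X : Type*} (ℓ : (X → ℝ) → X → ℝ → ℝ) (H : Set (X → ℝ))
    (h : X → ℝ) (x : X) (t : ℝ) : ℝ :=
  condRiskT ℓ h x t - sInf ((fun h' => condRiskT ℓ h' x t) '' H)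

/-- Generalization error `R_ℓ(h)`. -/
def genErr {X : Type*} [MeasurableSpace X] (μ : Measure X)
    (ℓ : (X → ℝ) → X → ℝ → ℝ) (η : X → ℝ) (h : X → ℝ) : ℝ :=
  ∫ x, condRisk ℓ η h x ∂μ

/-- Best-in-class error `R*_{ℓ,H}`. -/
def bestErr {X : Type*} [MeasurableSpace X] (μ : Measure X)
    (ℓ : (X → ℝ) → X → ℝ → ℝ) (η : X → ℝ) (H : Set (X → ℝ)) : ℝ :=
  sInf ((fun h => genErr μ ℓ η h) '' H)

/-- Minimizability gap `M_{ℓ,H}`. -/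
def minGap {X : Type*} [MeasurableSpace X] (μ : Measure X)
    (ℓ : (X → ℝ) → X → ℝ → ℝ) (η : X → ℝ) (H : Set (X → ℝ)) : ℝ :=
  bestErr μ ℓ η H - ∫ x, condRiskStar ℓ η H x ∂μ

/-- `ε`-truncation `⟨t⟩_ε = t · 1_{t > ε}`. -/
def trunc (ε t : ℝ) : ℝ := if ε < t then t else 0

/-- sign function: `+1` if `α ≥ 0`, `−1` otherwise. -/
def sgn (a : ℝ) : ℝ := if 0 ≤ a then 1 else -1

/-- The zero-one loss `ℓ_{0-1}(h,x,y) = 1_{sign(h(x)) ≠ y}`. -/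
def loss01 {X : Type*} (h : X → ℝ) (x : X) (y : ℝ) : ℝ :=
  if sgn (h x) ≠ y then 1 else 0

/-- Margin-based loss `ℓ_Φ(h,x,y) = Φ(y h(x))`. -/
def marginLoss {X : Type*} (Φ : ℝ → ℝ) (h : X → ℝ) (x : X) (y : ℝ) : ℝ :=
  Φ (y * h x)

end

theorem aux_seq (Φ : ℝ → ℝ) : ∃ a : ℕ → ℝ, ∀ b : ℝ, ∀ ε > 0, ∃ n,
    |Φ (a n) - Φ b| < ε ∧ |Φ (-a n) - Φ (-b)| < ε := by
  let P : ℝ → ℝ × ℝ := fun a => (Φ a, Φ (-a))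
  obtain ⟨u, hu⟩ := TopologicalSpace.exists_dense_seq (Set.range P)
  choose a ha using fun n => (u n).2
  refine ⟨a, fun b ε hε => ?_⟩
  obtain ⟨n, hn⟩ := Metric.denseRange_iff.1 hu ⟨P b, b, rfl⟩ ε hε
  refine ⟨n, ?_⟩
  rw [Subtype.dist_eq, ← ha n, Prod.dist_eq, max_lt_iff, Real.dist_eq, Real.dist_eq,
    abs_sub_comm, abs_sub_comm (P b).2] at hn
  exact hn

theorem aux_bdd {X : Type*} (η : X → ℝ) (hη01 : ∀ x, η x ∈ Icc (0:ℝ) 1)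
    (Φ : ℝ → ℝ) (hΦpos : ∀ t, 0 ≤ Φ t) (g : X → ℝ) (x : X) :
    0 ≤ condRisk (marginLoss Φ) η g x := by
  have h := hη01 x
  have h1 : 0 ≤ 1 - η x := by linarith [h.2]
  exact add_nonneg (mul_nonneg h.1 (hΦpos _)) (mul_nonneg h1 (hΦpos _))

theorem aux_star_le {X : Type*} [MeasurableSpace X] (η : X → ℝ) (hη01 : ∀ x, η x ∈ Icc (0:ℝ) 1)
    (Φ : ℝ → ℝ) (hΦpos : ∀ t, 0 ≤ Φ t) (g : X → ℝ) (hg : Measurable g) (x : X) :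
    condRiskStar (marginLoss Φ) η {g : X → ℝ | Measurable g} x
      ≤ condRisk (marginLoss Φ) η g x := by
  refine csInf_le ⟨0, ?_⟩ ⟨g, hg, rfl⟩
  rintro _ ⟨g, -, rfl⟩
  exact aux_bdd η hη01 Φ hΦpos g x

theorem aux_star_nonneg {X : Type*} [MeasurableSpace X] (η : X → ℝ)
    (hη01 : ∀ x, η x ∈ Icc (0:ℝ) 1)
    (Φ : ℝ → ℝ) (hΦpos : ∀ t, 0 ≤ Φ t) (x : X) :
    0 ≤ condRiskStar (marginLoss Φ) η {g : X → ℝ | Measurable g} x := by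
  refine Real.sInf_nonneg ?_
  rintro _ ⟨g, -, rfl⟩
  exact aux_bdd η hη01 Φ hΦpos g x

theorem aux_approx {X : Type*} [MeasurableSpace X] (η : X → ℝ) (hη01 : ∀ x, η x ∈ Icc (0:ℝ) 1)
    (Φ : ℝ → ℝ) (a : ℕ → ℝ) (ha : ∀ b : ℝ, ∀ ε > 0, ∃ n,
    |Φ (a n) - Φ b| < ε ∧ |Φ (-a n) - Φ (-b)| < ε) (x : X) (ε : ℝ) (hε : 0 < ε) :
    ∃ n, condRisk (marginLoss Φ) η (fun _ => a n) x
      < condRiskStar (marginLoss Φ) η {g : X → ℝ | Measurable g} x + ε := by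
  have hne : ((fun h => condRisk (marginLoss Φ) η h x) '' {g : X → ℝ | Measurable g}).Nonempty :=
    ⟨_, fun _ => 0, measurable_const, rfl⟩
  obtain ⟨_, ⟨g, hg, rfl⟩, hlt⟩ := exists_lt_of_csInf_lt hne
    (lt_add_of_pos_right (sInf _) (half_pos hε))
  obtain ⟨n, h1, h2⟩ := ha (g x) (ε / 2) (half_pos hε)
  refine ⟨n, ?_⟩
  have h := hη01 x
  have hh : 0 ≤ 1 - η x := by linarith [h.2]
  have e1 := mul_le_mul_of_nonneg_left (abs_lt.1 h1).2.le h.1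
  have e2 := mul_le_mul_of_nonneg_left (abs_lt.1 h2).2.le hh
  unfold condRiskStar
  simp only [condRisk, condRiskT, marginLoss, one_mul, neg_mul] at hlt ⊢
  linarith

theorem aux_star_meas {X : Type*} [MeasurableSpace X] (η : X → ℝ) (hηmeas : Measurable η)
    (hη01 : ∀ x, η x ∈ Icc (0:ℝ) 1)
    (Φ : ℝ → ℝ) (hΦpos : ∀ t, 0 ≤ Φ t) :
    Measurable (condRiskStar (marginLoss Φ) η {g : X → ℝ | Measurable g}) := by
  obtain ⟨a, ha⟩ := aux_seq Φ
  have : condRiskStar (marginLoss Φ) η {g : X → ℝ | Measurable g}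
      = fun x => ⨅ n, condRisk (marginLoss Φ) η (fun _ => a n) x := by
    funext x
    apply le_antisymm
    · exact le_ciInf fun n => aux_star_le η hη01 Φ hΦpos _ measurable_const x
    · refine le_of_forall_pos_le_add fun ε hε => ?_
      obtain ⟨n, hn⟩ := aux_approx η hη01 Φ a ha x ε hε
      refine (ciInf_le ⟨0, ?_⟩ n).trans hn.le
      rintro _ ⟨m, rfl⟩
      exact aux_bdd η hη01 Φ hΦpos _ x
  rw [this]
  refine Measurable.iInf fun n => ?_
  change Measurable fun x => η x * Φ (1 * a n) + (1 - η x) * Φ (-1 * a n)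
  fun_prop

theorem aux_select {X : Type*} [MeasurableSpace X] (η : X → ℝ) (hηmeas : Measurable η)
    (hη01 : ∀ x, η x ∈ Icc (0:ℝ) 1)
    (Φ : ℝ → ℝ) (hΦpos : ∀ t, 0 ≤ Φ t) (ε : ℝ) (hε : 0 < ε) :
    ∃ g : X → ℝ, Measurable g ∧ ∀ x, condRisk (marginLoss Φ) η g x
      ≤ condRiskStar (marginLoss Φ) η {g : X → ℝ | Measurable g} x + ε := by
  classical
  obtain ⟨a, ha⟩ := aux_seq Φ
  have hex := fun x => aux_approx η hη01 Φ a ha x ε hε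
  refine ⟨fun x => a (Nat.find (hex x)), ?_, fun x => (Nat.find_spec (hex x)).le⟩
  refine (measurable_of_countable a).comp (measurable_find hex fun n => ?_)
  refine measurableSet_lt ?_ ((aux_star_meas η hηmeas hη01 Φ hΦpos).add_const ε)
  change Measurable fun x => η x * Φ (1 * a n) + (1 - η x) * Φ (-1 * a n)
  fun_prop

theorem aux_01 {X : Type*} (η : X → ℝ) (hη01 : ∀ x, η x ∈ Icc (0:ℝ) 1) (h g : X → ℝ) (x : X) :
    condRisk loss01 η h x - condRisk loss01 η g x ≤ 2 * |η x - 1/2| ∧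
    (¬ sgn (h x) * (η x - 1/2) ≤ 0 → condRisk loss01 η h x - condRisk loss01 η g x ≤ 0) := by
  have h1 := le_abs_self (η x - 1/2)
  have h2 := neg_abs_le (η x - 1/2)
  have h3 := abs_nonneg (η x - 1/2)
  have n1 : ¬ ((1:ℝ) = -1) := by norm_num
  have n2 : ¬ ((-1:ℝ) = 1) := by norm_num
  simp only [condRisk, condRiskT, loss01, sgn]
  split_ifs <;> first | contradiction | simp_all | skip
  all_goals constructor <;> intros <;> linarith

open MeasureTheory Set in
/-- **Excess error power bound for the family of all measurable functions** (Corollary 2). -/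
theorem excess_error_power_bound_all_measurable
    {X : Type*} [MeasurableSpace X] [Nonempty X]
    (μ : Measure X) [IsProbabilityMeasure μ]
    (η : X → ℝ) (hηmeas : Measurable η) (hη01 : ∀ x, η x ∈ Icc (0:ℝ) 1)
    (Φ : ℝ → ℝ) (hΦpos : ∀ t, 0 ≤ Φ t)
    (hInt01 : ∀ g : X → ℝ, Measurable g → Integrable (condRisk loss01 η g) μ)
    (hIntΦ : ∀ g : X → ℝ, Measurable g → Integrable (condRisk (marginLoss Φ) η g) μ)
    (s c : ℝ) (hs : 1 ≤ s) (hc : 0 < c)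
    (hcond : ∀ x : X,
      |η x - 1/2| ≤
        c * (sInf ((fun g => deltaC (marginLoss Φ) η {g : X → ℝ | Measurable g} g x) ''
          {g : X → ℝ | Measurable g ∧ sgn (g x) * (η x - 1/2) ≤ 0})) ^ (1/s))
    (h : X → ℝ) (hh : Measurable h) :
    genErr μ loss01 η h - bestErr μ loss01 η {g : X → ℝ | Measurable g}
      ≤ 2 * c * (genErr μ (marginLoss Φ) η h
          - bestErr μ (marginLoss Φ) η {g : X → ℝ | Measurable g}) ^ (1/s) := by
  have hs0 : 0 < s := by linarith
  have hp0 : 0 ≤ 1 / s := by positivity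
  have hp1 : 1 / s ≤ 1 := by rw [div_le_one hs0]; exact hs
  set H : Set (X → ℝ) := {g : X → ℝ | Measurable g} with hH
  set D : X → ℝ := deltaC (marginLoss Φ) η H h with hD
  have hSle := aux_star_le η hη01 Φ hΦpos
  have hS0 := aux_star_nonneg η hη01 Φ hΦpos
  have hSm := aux_star_meas η hηmeas hη01 Φ hΦpos
  have hSint : Integrable (condRiskStar (marginLoss Φ) η H) μ := by
    refine (hIntΦ h hh).mono' hSm.aestronglyMeasurable (ae_of_all _ fun x => ?_)
    rw [Real.norm_eq_abs, abs_of_nonneg (hS0 x)]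
    exact hSle h hh x
  have hD0 : ∀ x, 0 ≤ D x := fun x => sub_nonneg.2 (hSle h hh x)
  have hDint : Integrable D μ := (hIntΦ h hh).sub hSint
  have hcont : Continuous fun t : ℝ => t ^ (1 / s) := Real.continuous_rpow_const hp0
  have hDpint : Integrable (fun x => D x ^ (1 / s)) μ := by
    refine ((integrable_const (1:ℝ)).add hDint).mono'
      (hcont.comp_aestronglyMeasurable hDint.1) (ae_of_all _ fun x => ?_)
    rw [Real.norm_eq_abs, abs_of_nonneg (Real.rpow_nonneg (hD0 x) _)]
    simp only [Pi.add_apply]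
    rcases le_total (D x) 1 with h1 | h1
    · linarith [Real.rpow_le_one (hD0 x) h1 hp0, hD0 x]
    · have := Real.rpow_le_rpow_of_exponent_le h1 hp1
      rw [Real.rpow_one] at this
      linarith
  have hJ : ∫ x, D x ^ (1 / s) ∂μ ≤ (∫ x, D x ∂μ) ^ (1 / s) :=
    (Real.concaveOn_rpow hp0 hp1).le_map_integral hcont.continuousOn isClosed_Ici
      (ae_of_all _ hD0) hDint hDpint
  have hbest : bestErr μ (marginLoss Φ) η H ≤ ∫ x, condRiskStar (marginLoss Φ) η H x ∂μ := by
    refine le_of_forall_pos_le_add fun ε hε => ?_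
    obtain ⟨g, hg, hgε⟩ := aux_select η hηmeas hη01 Φ hΦpos ε hε
    have h1 : bestErr μ (marginLoss Φ) η H ≤ genErr μ (marginLoss Φ) η g := by
      refine csInf_le ⟨0, ?_⟩ ⟨g, hg, rfl⟩
      rintro _ ⟨g, -, rfl⟩
      exact integral_nonneg fun x => aux_bdd η hη01 Φ hΦpos g x
    have h2 := integral_mono (hIntΦ g hg) (hSint.add (integrable_const ε)) hgε
    simp only [Pi.add_apply] at h2
    rw [integral_add hSint (integrable_const ε)] at h2
    simp only [integral_const, probReal_univ, one_smul] at h2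
    exact h1.trans h2
  have hDle : ∫ x, D x ∂μ ≤ genErr μ (marginLoss Φ) η h - bestErr μ (marginLoss Φ) η H := by
    have : ∫ x, D x ∂μ = genErr μ (marginLoss Φ) η h
        - ∫ x, condRiskStar (marginLoss Φ) η H x ∂μ := integral_sub (hIntΦ h hh) hSint
    linarith
  have hpow := hJ.trans (Real.rpow_le_rpow (integral_nonneg hD0) hDle hp0)
  have hpt : ∀ g : X → ℝ, ∀ x,
      condRisk loss01 η h x - condRisk loss01 η g x ≤ 2 * c * D x ^ (1 / s) := by
    intro g x
    obtain ⟨h1, h2⟩ := aux_01 η hη01 h g x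
    by_cases hsg : sgn (h x) * (η x - 1/2) ≤ 0
    · have hlow : ∀ y ∈ ((fun g => deltaC (marginLoss Φ) η H g x) ''
          {g : X → ℝ | Measurable g ∧ sgn (g x) * (η x - 1/2) ≤ 0}), 0 ≤ y := by
        rintro _ ⟨g, hg, rfl⟩
        exact sub_nonneg.2 (hSle g hg.1 x)
      have h3 := Real.rpow_le_rpow (Real.sInf_nonneg hlow)
        (csInf_le ⟨0, hlow⟩ ⟨h, ⟨hh, hsg⟩, rfl⟩) hp0
      have h4 := (hcond x).trans (mul_le_mul_of_nonneg_left h3 hc.le)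
      have h5 : |η x - 1/2| ≤ c * D x ^ (1 / s) := h4
      linarith
    · have := mul_nonneg hc.le (Real.rpow_nonneg (hD0 x) (1 / s))
      linarith [h2 hsg]
  have hkey : genErr μ loss01 η h - 2 * c * ∫ x, D x ^ (1 / s) ∂μ ≤ bestErr μ loss01 η H := by
    refine le_csInf ⟨_, h, hh, rfl⟩ ?_
    rintro _ ⟨g, hg, rfl⟩
    have h1 := integral_mono ((hInt01 h hh).sub (hInt01 g hg)) (hDpint.const_mul (2 * c)) (hpt g)
    simp only [Pi.sub_apply] at h1
    rw [integral_sub (hInt01 h hh) (hInt01 g hg), integral_const_mul] at h1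
    simp only [genErr]
    linarith
  have := mul_le_mul_of_nonneg_left hpow (by positivity : 0 ≤ 2 * c)
  linarith
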